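/- Suppose there is a decreasing function β : (0,∞) → (0,∞) such that the super Poincaré inequality μ_V(f²) ≤ s · 𝓔_{α,V}(f,f) + β(s) · μ_V(|f|)² holds for all s > 0 and f ∈ C_b^∞(ℝ^d). Then: (i) for every λ > 0, ∫ e^{λ|x|} μ_V(dx) < ∞; and (ii) ∫ F(|x|) μ_V(dx) < ∞, where F(r) := ∫_1^∞ e^{rλ} h(λ) dλ with h(λ) := exp{ −(1+c₀)λ − λ ∫_1^λ s^{−2} log[ 2 β( 1/(c₁ s² e^{2s}) ) ] ds }, c₀ := log( ∫ e^{|x|} μ_V(dx) ), and c₁ := ∫_{{|z| ≤ 1}} |z|^{−(d+α−2)} dz. -/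

import Mathlib

open MeasureTheory Real Set Metric Filter

noncomputable section

/-- Euclidean space `ℝ^d`. -/
abbrev Ed (d : ℕ) := EuclideanSpace ℝ (Fin d)

/-- The probability measure `μ_V(dx) = C_V e^{-V(x)} dx` with `C_V = (∫ e^{-V})⁻¹`. -/
def muV (d : ℕ) (V : Ed d → ℝ) : Measure (Ed d) :=
  (volume : Measure (Ed d)).withDensity
    fun x => ENNReal.ofReal ((∫ y, Real.exp (-V y))⁻¹ * Real.exp (-V x))

/-- `f ∈ C_b^∞(ℝ^d)`: smooth with bounded derivatives of every order. -/
def CbSmooth (d : ℕ) (f : Ed d → ℝ) : Prop :=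
  ContDiff ℝ (⊤ : ℕ∞) f ∧ ∀ n : ℕ, ∃ C : ℝ, ∀ x, ‖iteratedFDeriv ℝ n f x‖ ≤ C

/-- `V` is locally bounded. -/
def LocallyBounded (d : ℕ) (V : Ed d → ℝ) : Prop :=
  ∀ r : ℝ, ∃ M : ℝ, ∀ x : Ed d, ‖x‖ ≤ r → |V x| ≤ M

/-- The nonlocal Dirichlet form with finite range jumps `𝓔_{α,V}`. -/
def formE (d : ℕ) (α : ℝ) (V f : Ed d → ℝ) : ℝ :=
  (1/2) * ∫ x, (∫ y in {y : Ed d | dist x y ≤ 1},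
      (f x - f y) ^ 2 / dist x y ^ ((d : ℝ) + α)) ∂(muV d V)

/-- The nonlocal Dirichlet form with large jumps `𝓓_{α,V}`. -/
def formD (d : ℕ) (α : ℝ) (V f : Ed d → ℝ) : ℝ :=
  (1/2) * ∫ x, (∫ y in {y : Ed d | 1 < dist x y},
      (f x - f y) ^ 2 / dist x y ^ ((d : ℝ) + α)) ∂(muV d V)

/-- `inf_{z : |x|-1 ≤ |z| ≤ |x|-1/2} e^{-V(z)}`. -/
def infAnn (d : ℕ) (V : Ed d → ℝ) (x : Ed d) : ℝ :=
  sInf ((fun z => Real.exp (-V z)) '' {z : Ed d | ‖x‖ - 1 ≤ ‖z‖ ∧ ‖z‖ ≤ ‖x‖ - 1/2})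

/-- `sup_{z : |x| ≤ |z| ≤ |x|+1} e^{-V(z)}`. -/
def supAnn (d : ℕ) (V : Ed d → ℝ) (x : Ed d) : ℝ :=
  sSup ((fun z => Real.exp (-V z)) '' {z : Ed d | ‖x‖ ≤ ‖z‖ ∧ ‖z‖ ≤ ‖x‖ + 1})

/-- `K(r) = sup_{|x| ≤ r} e^{-V(x)}`. -/
def Kfun (d : ℕ) (V : Ed d → ℝ) (r : ℝ) : ℝ :=
  sSup ((fun x => Real.exp (-V x)) '' {x : Ed d | ‖x‖ ≤ r})

/-- `k(r) = inf_{|x| ≤ r+1} e^{-V(x)}`. -/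
def kfun (d : ℕ) (V : Ed d → ℝ) (r : ℝ) : ℝ :=
  sInf ((fun x => Real.exp (-V x)) '' {x : Ed d | ‖x‖ ≤ r + 1})

/-- The constant `(1/α)·2^{2d+1}·(e + e^{1/2})·(2^α − 1)`. -/
def thresholdConst (d : ℕ) (α : ℝ) : ℝ :=
  (1/α) * (2:ℝ) ^ (2*d+1) * (Real.exp 1 + Real.exp (1/2)) * ((2:ℝ) ^ α - 1)

/-- `c₁ = ∫_{|z| ≤ 1} |z|^{-(d+α-2)} dz`. -/
def c1const (d : ℕ) (α : ℝ) : ℝ :=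
  ∫ z in {z : Ed d | ‖z‖ ≤ 1}, ‖z‖ ^ (-((d:ℝ) + α - 2))

/-- `h(λ) = exp{ −(1+c₀)λ − λ ∫_1^λ s^{-2} log[2β(1/(c₁ s² e^{2s}))] ds }`,
where `c₀ = log(∫ e^{|x|} dμ_V)`. -/
def hfun (d : ℕ) (α : ℝ) (V : Ed d → ℝ) (β : ℝ → ℝ) (lam : ℝ) : ℝ :=
  Real.exp (-(1 + Real.log (∫ x, Real.exp ‖x‖ ∂(muV d V))) * lam -
    lam * ∫ s in (1:ℝ)..lam,
      (s ^ 2)⁻¹ * Real.log (2 * β (1 / (c1const d α * s ^ 2 * Real.exp (2*s)))))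

/-- `F(r) = ∫_1^∞ e^{rλ} h(λ) dλ`. -/
def Ffun (d : ℕ) (α : ℝ) (V : Ed d → ℝ) (β : ℝ → ℝ) (r : ℝ) : ℝ :=
  ∫ lam in Ioi (1:ℝ), Real.exp (r * lam) * hfun d α V β lam

section RealAnalysis

/-- A smooth `1`-Lipschitz truncation of the identity. -/
lemma exists_smooth_truncation (R : ℝ) :
    ∃ θ : ℝ → ℝ, ContDiff ℝ (⊤ : ℕ∞) θ ∧ (∀ s t, |θ s - θ t| ≤ |s - t|) ∧
      (∀ t, 0 ≤ t → θ t ≤ t) ∧ (∀ t, 0 ≤ t → t ≤ R → θ t = t) ∧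
      ∀ t, R + 1 ≤ t → θ t = θ (R + 1) := by
  set T : ℝ → ℝ := fun u => smoothTransition (R + 1 - u)
  have hTc : ContDiff ℝ (⊤ : ℕ∞) T :=
    smoothTransition.contDiff.comp (contDiff_const.sub contDiff_id)
  have hcont : Continuous T := hTc.continuous
  have hder : ∀ t, HasDerivAt (fun t => ∫ u in (0 : ℝ)..t, T u) (T t) t := fun t =>
    (hcont.integral_hasStrictDerivAt 0 t).hasDerivAt
  have hint : ∀ a b, IntervalIntegrable T volume a b := fun a b => hcont.intervalIntegrable a b
  have hsub : ∀ s t, (∫ u in (0 : ℝ)..s, T u) - ∫ u in (0 : ℝ)..t, T u = ∫ u in t..s, T u :=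
    fun s t => intervalIntegral.integral_interval_sub_left (hint _ _) (hint _ _)
  refine ⟨fun t => ∫ u in (0 : ℝ)..t, T u, ?_, ?_, ?_, ?_, ?_⟩
  · refine contDiff_infty_iff_deriv.2 ⟨fun t => (hder t).differentiableAt, ?_⟩
    rwa [show deriv (fun t => ∫ u in (0 : ℝ)..t, T u) = T from funext fun t => (hder t).deriv]
  · intro s t
    rw [hsub, ← Real.norm_eq_abs]
    simpa using intervalIntegral.norm_integral_le_of_norm_le_const (f := T) (C := 1) (a := t)
      (b := s) fun u _ => by
        rw [Real.norm_eq_abs, abs_of_nonneg (smoothTransition.nonneg _)]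
        exact smoothTransition.le_one _
  · intro t ht
    simpa using intervalIntegral.integral_mono_on (g := fun _ => (1 : ℝ)) ht (hint 0 t) (by simp)
      fun u _ => smoothTransition.le_one _
  · intro t ht htR
    have : ∫ u in (0 : ℝ)..t, T u = ∫ u in (0 : ℝ)..t, (1 : ℝ) := by
      refine intervalIntegral.integral_congr fun u hu => ?_
      rw [uIcc_of_le ht] at hu
      exact smoothTransition.one_of_one_le (by linarith [hu.2])
    simpa using this
  · intro t ht
    have : ∫ u in (R + 1)..t, T u = ∫ u in (R + 1)..t, (0 : ℝ) := by
      refine intervalIntegral.integral_congr fun u hu => ?_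
      rw [uIcc_of_le ht] at hu
      exact smoothTransition.zero_of_nonpos (by linarith [hu.1])
    have h := hsub t (R + 1)
    rw [this] at h
    simp only [intervalIntegral.integral_zero] at h
    exact sub_eq_zero.1 h

lemma abs_sqrt_add_sq_sub_le (c a b : ℝ) :
    |√(c ^ 2 + a ^ 2) - √(c ^ 2 + b ^ 2)| ≤ |a - b| := by
  have hA := Real.sq_sqrt (show 0 ≤ c ^ 2 + a ^ 2 by positivity)
  have hB := Real.sq_sqrt (show 0 ≤ c ^ 2 + b ^ 2 by positivity)
  have hA0 := Real.sqrt_nonneg (c ^ 2 + a ^ 2)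
  have hB0 := Real.sqrt_nonneg (c ^ 2 + b ^ 2)
  refine sq_le_sq.1 ?_
  have key : c ^ 2 + a * b ≤ √(c ^ 2 + a ^ 2) * √(c ^ 2 + b ^ 2) := by
    rw [← Real.sqrt_mul (by positivity)]
    exact Real.le_sqrt_of_sq_le (by nlinarith [sq_nonneg (c * (a - b))])
  nlinarith

/-- A Herbst-type argument: the differential inequality bounds the derivative of `L s / s` by
`B s / s ^ 2`, which is integrated from `1`. -/
lemma le_mul_add_mul_integral_of_deriv_le {L L' B : ℝ → ℝ}
    (hL : ∀ s, 1 ≤ s → HasDerivAt L (L' s) s) (hB : MonotoneOn B (Ici 1))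
    (hle : ∀ s, 1 ≤ s → s * L' s ≤ B s + L s) {lam : ℝ} (hlam : 1 ≤ lam) :
    L lam ≤ L 1 * lam + lam * ∫ s in (1 : ℝ)..lam, (s ^ 2)⁻¹ * B s := by
  have hder : ∀ s, 1 ≤ s → HasDerivAt (fun s => L s / s) ((L' s * s - L s * 1) / s ^ 2) s :=
    fun s hs => (hL s hs).div (hasDerivAt_id s) (by positivity)
  have hint : IntervalIntegrable (fun s => (s ^ 2)⁻¹ * B s) volume 1 lam := by
    refine IntervalIntegrable.continuousOn_mul ?_ ?_
    · exact (hB.mono (by rw [uIcc_of_le hlam]; exact Icc_subset_Ici_self)).intervalIntegrable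
    · refine ContinuousOn.inv₀ (by fun_prop) fun s hs => ?_
      rw [uIcc_of_le hlam] at hs
      have := hs.1
      positivity
  have h := intervalIntegral.sub_le_integral_of_hasDeriv_right_of_le (g := fun s => L s / s) hlam
    (fun s hs => (hder s hs.1).continuousAt.continuousWithinAt)
    (fun s hs => (hder s hs.1.le).hasDerivWithinAt)
    ((intervalIntegrable_iff_integrableOn_Icc_of_le hlam).1 hint)
    (fun s hs => by
      have := hle s hs.1.le
      have h0 : (0 : ℝ) < s := by linarith [hs.1]
      rw [div_eq_inv_mul]
      gcongr
      linarith)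
  have h0 : 0 < lam := by linarith
  rw [sub_le_iff_le_add, div_le_iff₀ h0] at h
  simp only [div_one] at h
  linarith

end RealAnalysis

section Approximation

variable {d : ℕ}

/-- Smooth `1`-Lipschitz approximations of the norm from below, constant near infinity. -/
lemma exists_smooth_truncated_norm (d n : ℕ) :
    ∃ g : Ed d → ℝ, ContDiff ℝ (⊤ : ℕ∞) g ∧ (∀ x y, |g x - g y| ≤ dist x y) ∧
      (∀ x, g x ≤ ‖x‖) ∧ (∀ x, ‖x‖ ≤ n → ‖x‖ - 1 / ((n : ℝ) + 1) ≤ g x) ∧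
      ∃ K : ℝ, ∀ x, (n : ℝ) + 2 ≤ ‖x‖ → g x = K := by
  obtain ⟨θ, hθs, hθl, hθt, hθid, hθK⟩ := exists_smooth_truncation n
  set ε : ℝ := 1 / ((n : ℝ) + 1) with hε
  have hε0 : 0 < ε := by positivity
  have hε1 : ε ≤ 1 := by
    rw [hε, div_le_one (by positivity)]
    linarith [Nat.cast_nonneg (α := ℝ) n]
  set S : Ed d → ℝ := fun x => √(ε ^ 2 + ‖x‖ ^ 2) with hS
  have hS0 : ∀ x, ε ≤ S x := fun x => Real.le_sqrt_of_sq_le (by nlinarith [sq_nonneg ‖x‖])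
  have hS1 : ∀ x, S x ≤ ‖x‖ + ε := fun x =>
    (Real.sqrt_le_left (by positivity)).2 (by nlinarith [norm_nonneg x])
  have hS2 : ∀ x, ‖x‖ ≤ S x := fun x => Real.le_sqrt_of_sq_le (by nlinarith)
  have hSsm : ContDiff ℝ (⊤ : ℕ∞) S :=
    (contDiff_const.add (contDiff_norm_sq ℝ)).sqrt fun x => by positivity
  refine ⟨fun x => θ (S x - ε), hθs.comp (hSsm.sub contDiff_const), fun x y => ?_, fun x => ?_,
    fun x hx => ?_, θ (n + 1), fun x hx => ?_⟩
  · refine (hθl _ _).trans ?_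
    rw [sub_sub_sub_cancel_right, dist_eq_norm]
    exact (abs_sqrt_add_sq_sub_le _ _ _).trans (abs_norm_sub_norm_le _ _)
  · exact (hθt _ (by linarith [hS0 x])).trans (by linarith [hS1 x])
  · have := hθid (S x - ε) (by linarith [hS0 x]) (by linarith [hS1 x])
    linarith [hS2 x]
  · exact hθK _ (by linarith [hS2 x])

lemma CbSmooth.of_eq_const_at_infinity {f : Ed d → ℝ} (hf : ContDiff ℝ (⊤ : ℕ∞) f) {r K : ℝ}
    (hK : ∀ x, r ≤ ‖x‖ → f x = K) : CbSmooth d f := by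
  refine ⟨hf, fun n => ?_⟩
  have hF : ContDiff ℝ (⊤ : ℕ∞) (fun x => f x - K) := hf.sub contDiff_const
  have hsupp : HasCompactSupport (fun x => f x - K) :=
    HasCompactSupport.intro (isCompact_closedBall (0 : Ed d) r) fun x hx => by
      rw [hK x, sub_self]
      simp only [Metric.mem_closedBall, dist_zero_right, not_le] at hx
      exact hx.le
  have hcont : Continuous (iteratedFDeriv ℝ n fun x => f x - K) :=
    hF.continuous_iteratedFDeriv (by exact_mod_cast le_top)
  obtain ⟨C, hC⟩ := hcont.bounded_above_of_compact_support (hsupp.iteratedFDeriv n)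
  obtain ⟨C', hC'⟩ : ∃ C' : ℝ, ∀ x : Ed d, ‖iteratedFDeriv ℝ n (fun _ : Ed d => K) x‖ ≤ C' := by
    rcases eq_or_ne n 0 with rfl | hn
    · exact ⟨‖K‖, fun x => by rw [norm_iteratedFDeriv_zero]⟩
    · exact ⟨0, fun x => by simp [iteratedFDeriv_const_of_ne hn]⟩
  refine ⟨C + C', fun x => ?_⟩
  have hsum : iteratedFDeriv ℝ n f x =
      iteratedFDeriv ℝ n (fun x => f x - K) x + iteratedFDeriv ℝ n (fun _ => K) x := by
    rw [← iteratedFDeriv_add_apply (hF.of_le (by exact_mod_cast le_top)).contDiffAt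
      contDiff_const.contDiffAt]
    congr 1
    ext y
    simp
  rw [hsum]
  exact (norm_add_le _ _).trans (add_le_add (hC x) (hC' x))

end Approximation

section Energy

variable {d : ℕ} {α : ℝ}

lemma integrableOn_c1const (hd : 1 ≤ d) (hα : α < 2) :
    IntegrableOn (fun z : Ed d => ‖z‖ ^ (-((d : ℝ) + α - 2))) {z | ‖z‖ ≤ 1} := by
  have h := integrableOn_ball_of_norm_le_rpow (μ := (volume : Measure (Ed d))) (r := 2) (C := 1)
    (α := (d : ℝ) + α - 2) (f := fun z : Ed d => ‖z‖ ^ (-((d : ℝ) + α - 2))) (by simpa using hd)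
    (by simp; linarith)
    (ae_of_all _ fun x => by
      rw [one_mul, Real.norm_eq_abs, abs_of_nonneg (by positivity)])
    (by exact (measurable_norm.pow_const _).aestronglyMeasurable)
  refine h.mono_set fun z hz => ?_
  simp only [mem_ofPred_eq] at hz
  simp only [mem_ball, dist_zero_right]
  linarith

lemma c1const_pos (hd : 1 ≤ d) (hα : α < 2) : 0 < c1const d α := by
  have hpos : (0 : ENNReal) < volume (ball (0 : Ed d) 1 \ {0}) := by
    have : Nonempty (Fin d) := ⟨⟨0, hd⟩⟩
    rw [measure_sdiff_null (measure_singleton _)]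
    exact measure_ball_pos _ _ one_pos
  refine (setIntegral_pos_iff_support_of_nonneg_ae
    (ae_of_all _ fun z => by positivity) (integrableOn_c1const hd hα)).2 (hpos.trans_le ?_)
  refine measure_mono fun z hz => ⟨?_, ?_⟩
  · exact (Real.rpow_pos_of_pos (norm_pos_iff.2 hz.2) _).ne'
  · have := hz.1
    simp only [mem_ball, dist_zero_right] at this
    exact this.le

lemma abs_exp_sub_one_le_mul_exp_abs (u : ℝ) : |Real.exp u - 1| ≤ |u| * Real.exp |u| := by
  rcases le_total 0 u with hu | hu
  · have h1 := Real.add_one_le_exp (-u)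
    rw [abs_of_nonneg hu, abs_of_nonneg (by linarith [Real.add_one_le_exp u])]
    have h2 : Real.exp (-u) * Real.exp u = 1 := by rw [← Real.exp_add]; simp
    nlinarith [Real.exp_pos u]
  · rw [abs_of_nonpos hu, abs_of_nonpos (by linarith [Real.exp_le_one_iff.2 hu])]
    nlinarith [Real.add_one_le_exp u, Real.one_le_exp (neg_nonneg.2 hu)]

lemma sq_exp_sub_exp_le {lam a b δ : ℝ} (hlam : 0 ≤ lam) (hab : |a - b| ≤ δ) (hδ : δ ≤ 1) :
    (Real.exp (lam * a) - Real.exp (lam * b)) ^ 2 ≤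
      lam ^ 2 * Real.exp (2 * lam) * Real.exp (2 * lam * a) * δ ^ 2 := by
  have hfac : Real.exp (lam * a) - Real.exp (lam * b) =
      -(Real.exp (lam * a) * (Real.exp (lam * (b - a)) - 1)) := by
    rw [mul_sub, ← Real.exp_add, show lam * a + lam * (b - a) = lam * b by ring]
    ring
  have hu : |lam * (b - a)| ≤ lam * δ := by
    rw [abs_mul, abs_of_nonneg hlam, abs_sub_comm]
    gcongr
  have hbound : |Real.exp (lam * (b - a)) - 1| ≤ lam * δ * Real.exp lam := by
    refine (abs_exp_sub_one_le_mul_exp_abs _).trans ?_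
    have : Real.exp |lam * (b - a)| ≤ Real.exp lam := Real.exp_le_exp.2 (by nlinarith)
    exact mul_le_mul hu this (by positivity) ((abs_nonneg _).trans hu)
  have hsq : (Real.exp (lam * (b - a)) - 1) ^ 2 ≤ (lam * δ * Real.exp lam) ^ 2 := by
    rw [← sq_abs]
    gcongr
  calc (Real.exp (lam * a) - Real.exp (lam * b)) ^ 2
      = Real.exp (lam * a) ^ 2 * (Real.exp (lam * (b - a)) - 1) ^ 2 := by rw [hfac]; ring
    _ ≤ Real.exp (lam * a) ^ 2 * (lam * δ * Real.exp lam) ^ 2 := by gcongr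
    _ = _ := by
      rw [show 2 * lam = lam + lam by ring, Real.exp_add, add_mul, Real.exp_add]
      ring

lemma setIntegral_jump_exp_le (hd : 1 ≤ d) (hα : α < 2) {g : Ed d → ℝ}
    (hg : ∀ x y, |g x - g y| ≤ dist x y) {lam : ℝ} (hlam : 0 ≤ lam) (x : Ed d) :
    ∫ y in {y : Ed d | dist x y ≤ 1},
        (Real.exp (lam * g x) - Real.exp (lam * g y)) ^ 2 / dist x y ^ ((d : ℝ) + α) ≤
      lam ^ 2 * Real.exp (2 * lam) * c1const d α * Real.exp (2 * lam * g x) := by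
  set A := lam ^ 2 * Real.exp (2 * lam) * Real.exp (2 * lam * g x) with hA
  have hmp : MeasurePreserving (fun y : Ed d => x - y) volume volume :=
    Measure.measurePreserving_sub_left volume x
  have hemb : MeasurableEmbedding (fun y : Ed d => x - y) :=
    (Homeomorph.subLeft x).measurableEmbedding
  have hset : {y : Ed d | dist x y ≤ 1} = (fun y => x - y) ⁻¹' {z | ‖z‖ ≤ 1} := by
    ext y
    simp [dist_eq_norm]
  have hint : IntegrableOn (fun y : Ed d => ‖x - y‖ ^ (-((d : ℝ) + α - 2)))
      {y | dist x y ≤ 1} := by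
    rw [hset]
    exact (hmp.integrableOn_comp_preimage hemb).2 (integrableOn_c1const hd hα)
  have hval : ∫ y in {y : Ed d | dist x y ≤ 1}, ‖x - y‖ ^ (-((d : ℝ) + α - 2)) =
      c1const d α := by
    rw [hset, c1const]
    exact hmp.setIntegral_preimage_emb hemb (fun z : Ed d => ‖z‖ ^ (-((d : ℝ) + α - 2))) _
  have hmeas : MeasurableSet {y : Ed d | dist x y ≤ 1} :=
    measurableSet_le (by fun_prop) measurable_const
  calc _ ≤ ∫ y in {y : Ed d | dist x y ≤ 1}, A * ‖x - y‖ ^ (-((d : ℝ) + α - 2)) := by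
        refine integral_mono_of_nonneg (ae_of_all _ fun y => by positivity) (hint.const_mul A) ?_
        refine (ae_restrict_iff' hmeas).2 (ae_of_all _ fun y hy => ?_)
        rcases eq_or_ne x y with rfl | hxy
        · simp only [sub_self, ne_eq, OfNat.ofNat_ne_zero, not_false_eq_true, zero_pow, zero_div]
          positivity
        · have hpos : 0 < dist x y := dist_pos.2 hxy
          have h := sq_exp_sub_exp_le hlam (hg x y) hy
          dsimp only
          rw [← dist_eq_norm, neg_sub, Real.rpow_sub hpos, ← mul_div_assoc, Real.rpow_two]
          gcongr
    _ = _ := by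
        rw [integral_const_mul, hval]
        ring

lemma formE_exp_le (hd : 1 ≤ d) (hα : α < 2) {V g : Ed d → ℝ}
    (hg : ∀ x y, |g x - g y| ≤ dist x y) {lam : ℝ} (hlam : 0 ≤ lam)
    (hint : Integrable (fun x => Real.exp (2 * lam * g x)) (muV d V)) :
    formE d α V (fun x => Real.exp (lam * g x)) ≤
      (1 / 2) * (c1const d α * lam ^ 2 * Real.exp (2 * lam)) *
        ∫ x, Real.exp (2 * lam * g x) ∂(muV d V) := by
  rw [formE, mul_assoc (1 / 2 : ℝ), ← integral_const_mul (c1const d α * _ * _)]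
  refine mul_le_mul_of_nonneg_left ?_ (by norm_num : (0 : ℝ) ≤ 1 / 2)
  refine integral_mono_of_nonneg
    (ae_of_all _ fun x => integral_nonneg fun y => by positivity) (hint.const_mul _)
    (ae_of_all _ fun x => (setIntegral_jump_exp_le hd hα hg hlam x).trans_eq (by ring))

end Energy

section Abstract

open ProbabilityTheory Topology

variable {Ω : Type*} {mΩ : MeasurableSpace Ω} {μ : Measure Ω} {X : Ω → ℝ}

lemma exists_measureReal_gt_le [IsFiniteMeasure μ] (hX : Measurable X) {ε : ℝ} (hε : 0 < ε) :
    ∃ R : ℝ, μ.real {ω | R < X ω} ≤ ε := by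
  have hanti : Antitone fun n : ℕ => {ω | (n : ℝ) < X ω} := fun m n hmn ω hω =>
    (Nat.cast_le.2 hmn).trans_lt (show (n : ℝ) < X ω from hω)
  have hempty : ⋂ n : ℕ, {ω | (n : ℝ) < X ω} = ∅ := by
    refine eq_empty_of_forall_notMem fun ω hω => ?_
    obtain ⟨n, hn⟩ := exists_nat_ge (X ω)
    exact absurd (mem_iInter.1 hω n) (not_lt.2 hn)
  have h := tendsto_measure_iInter_atTop (μ := μ)
    (fun n : ℕ => (measurableSet_lt measurable_const hX).nullMeasurableSet) hanti
    ⟨0, measure_ne_top _ _⟩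
  rw [hempty, measure_empty] at h
  have h' := (ENNReal.tendsto_toReal ENNReal.zero_ne_top).comp h
  have hε' : (0 : ENNReal).toReal < ε := by simpa using hε
  obtain ⟨n, hn⟩ := (h'.eventually (Iic_mem_nhds hε')).exists
  exact ⟨n, hn⟩

/-- A doubling inequality for `∫ exp (lam * G)` self-improves to a bound which depends on `G`
only through the tail of a majorant `X`. -/
lemma integral_exp_le_of_doubling [IsProbabilityMeasure μ] {G : Ω → ℝ} (hX : Measurable X)
    (hGX : ∀ ω, G ω ≤ X ω) {lam b R : ℝ} (hlam : 0 ≤ lam) (hb : 0 < b)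
    (hR : μ.real {ω | R < X ω} ≤ 1 / (4 * b))
    (h1 : Integrable (fun ω => Real.exp (lam * G ω)) μ)
    (h2 : Integrable (fun ω => Real.exp (2 * lam * G ω)) μ)
    (hdouble : ∫ ω, Real.exp (2 * lam * G ω) ∂μ ≤ b * (∫ ω, Real.exp (lam * G ω) ∂μ) ^ 2) :
    ∫ ω, Real.exp (2 * lam * G ω) ∂μ ≤ 4 * b * Real.exp (lam * R) ^ 2 := by
  set φ := ∫ ω, Real.exp (2 * lam * G ω) ∂μ with hφ
  set M := ∫ ω, Real.exp (lam * G ω) ∂μ with hM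
  have hφ0 : 0 < φ := integral_exp_pos h2
  have hM0 : 0 ≤ M := integral_nonneg fun ω => (Real.exp_pos _).le
  set A := {ω | R < X ω} with hA
  have hAm : MeasurableSet A := measurableSet_lt measurable_const hX
  set t := 1 / √(4 * b * φ) with ht
  have hsq : √(4 * b * φ) ^ 2 = 4 * b * φ := Real.sq_sqrt (by positivity)
  have hs0 : 0 < √(4 * b * φ) := Real.sqrt_pos.2 (by positivity)
  have ht0 : 0 < t := by positivity
  have hpt : ∀ ω, Real.exp (lam * G ω) ≤ Real.exp (lam * R) + A.indicator (fun _ => 1 / (2 * t)) ω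
      + t / 2 * Real.exp (2 * lam * G ω) := by
    intro ω
    by_cases hω : ω ∈ A
    · rw [indicator_of_mem hω, show 2 * lam * G ω = lam * G ω + lam * G ω by ring, Real.exp_add]
      have hid : 1 / (2 * t) + t / 2 * (Real.exp (lam * G ω) * Real.exp (lam * G ω)) -
          Real.exp (lam * G ω) = (1 - t * Real.exp (lam * G ω)) ^ 2 / (2 * t) := by
        field_simp
        ring
      have : 0 ≤ (1 - t * Real.exp (lam * G ω)) ^ 2 / (2 * t) := by positivity
      linarith [Real.exp_pos (lam * R)]
    · rw [indicator_of_notMem hω, add_zero]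
      have hle : G ω ≤ R := (hGX ω).trans (not_lt.1 hω)
      have : Real.exp (lam * G ω) ≤ Real.exp (lam * R) := by gcongr
      have : 0 ≤ t / 2 * Real.exp (2 * lam * G ω) := by positivity
      linarith
  have hMle : M ≤ Real.exp (lam * R) + μ.real A * (1 / (2 * t)) + t / 2 * φ := by
    have hi : Integrable (A.indicator (fun _ : Ω => 1 / (2 * t))) μ :=
      (integrable_const _).indicator hAm
    have hc : Integrable (fun _ : Ω => Real.exp (lam * R)) μ := integrable_const _
    have hci : Integrable (fun ω => Real.exp (lam * R) + A.indicator (fun _ => 1 / (2 * t)) ω) μ :=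
      hc.add hi
    calc M ≤ ∫ ω, (Real.exp (lam * R) + A.indicator (fun _ => 1 / (2 * t)) ω
          + t / 2 * Real.exp (2 * lam * G ω)) ∂μ :=
          integral_mono h1 (hci.add (h2.const_mul _)) hpt
      _ = _ := by
        rw [integral_add hci (h2.const_mul _), integral_add hc hi, integral_const_mul,
          integral_indicator_const _ hAm, ← hφ]
        simp
  have hMle' : M ≤ Real.exp (lam * R) + √(4 * b * φ) / (4 * b) := by
    have e1 : μ.real A * (1 / (2 * t)) ≤ 1 / (4 * b) * (1 / (2 * t)) := by gcongr
    have e2 : 1 / (4 * b) * (1 / (2 * t)) + t / 2 * φ = √(4 * b * φ) / (4 * b) := by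
      rw [ht]
      field_simp
      rw [hsq]
      ring
    linarith
  have hMsq : M ^ 2 ≤ 2 * Real.exp (lam * R) ^ 2 + 2 * (√(4 * b * φ) / (4 * b)) ^ 2 := by
    have : M ^ 2 ≤ (Real.exp (lam * R) + √(4 * b * φ) / (4 * b)) ^ 2 := by gcongr
    nlinarith [sq_nonneg (Real.exp (lam * R) - √(4 * b * φ) / (4 * b))]
  have e3 : b * (2 * (√(4 * b * φ) / (4 * b)) ^ 2) = φ / 2 := by
    rw [div_pow, hsq]
    field_simp
    ring
  have := hdouble.trans (mul_le_mul_of_nonneg_left hMsq hb.le)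
  rw [mul_add, e3] at this
  linarith

lemma integrable_exp_of_tendsto_of_bound {G : ℕ → Ω → ℝ} (hX : Measurable X)
    (hG : ∀ n, Measurable (G n)) (hlim : ∀ ω, Tendsto (fun n => G n ω) atTop (𝓝 (X ω)))
    {lam C : ℝ} (hint : ∀ n, Integrable (fun ω => Real.exp (lam * G n ω)) μ)
    (hbound : ∀ n, ∫ ω, Real.exp (lam * G n ω) ∂μ ≤ C) :
    Integrable (fun ω => Real.exp (lam * X ω)) μ := by
  refine ⟨by fun_prop, ?_⟩
  rw [hasFiniteIntegral_iff_ofReal (ae_of_all _ fun ω => (Real.exp_pos _).le)]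
  have hliminf : ∀ ω, ENNReal.ofReal (Real.exp (lam * X ω)) =
      liminf (fun n => ENNReal.ofReal (Real.exp (lam * G n ω))) atTop := fun ω =>
    (Tendsto.liminf_eq (ENNReal.tendsto_ofReal
      ((Real.continuous_exp.tendsto _).comp ((hlim ω).const_mul lam)))).symm
  calc ∫⁻ ω, ENNReal.ofReal (Real.exp (lam * X ω)) ∂μ
      = ∫⁻ ω, liminf (fun n => ENNReal.ofReal (Real.exp (lam * G n ω))) atTop ∂μ :=
        lintegral_congr hliminf
    _ ≤ liminf (fun n => ∫⁻ ω, ENNReal.ofReal (Real.exp (lam * G n ω)) ∂μ) atTop :=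
        lintegral_liminf_le fun n => by fun_prop
    _ ≤ ENNReal.ofReal C := by
        refine liminf_le_of_frequently_le' (Frequently.of_forall fun n => ?_)
        rw [← ofReal_integral_eq_lintegral_ofReal (hint n)
          (ae_of_all _ fun ω => (Real.exp_pos _).le)]
        exact ENNReal.ofReal_le_ofReal (hbound n)
    _ < ⊤ := ENNReal.ofReal_lt_top

/-- Passing to the limit in a doubling inequality along an approximation from below. -/
lemma doubling_of_approx [IsProbabilityMeasure μ] {G : ℕ → Ω → ℝ} (hX : Measurable X)
    (hG : ∀ n, Measurable (G n)) (hGX : ∀ n ω, G n ω ≤ X ω)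
    (hlim : ∀ ω, Tendsto (fun n => G n ω) atTop (𝓝 (X ω)))
    (hint : ∀ lam n, Integrable (fun ω => Real.exp (lam * G n ω)) μ)
    {b : ℝ → ℝ} (hb : ∀ lam, 0 < lam → 0 < b lam)
    (hdouble : ∀ lam, 0 < lam → ∀ n, ∫ ω, Real.exp (2 * lam * G n ω) ∂μ ≤
      b lam * (∫ ω, Real.exp (lam * G n ω) ∂μ) ^ 2) :
    ∀ lam, 0 < lam → Integrable (fun ω => Real.exp (lam * X ω)) μ ∧
      ∫ ω, Real.exp (2 * lam * X ω) ∂μ ≤ b lam * (∫ ω, Real.exp (lam * X ω) ∂μ) ^ 2 := by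
  have hI : ∀ lam, 0 < lam → Integrable (fun ω => Real.exp (2 * lam * X ω)) μ := by
    intro lam hlam
    have hb0 := hb lam hlam
    obtain ⟨R, hR⟩ := exists_measureReal_gt_le (μ := μ) hX
      (show 0 < 1 / (4 * b lam) by positivity)
    exact integrable_exp_of_tendsto_of_bound hX hG hlim (hint _) fun n =>
      integral_exp_le_of_doubling hX (hGX n) hlam.le hb0 hR (hint _ n) (hint _ n)
        (hdouble lam hlam n)
  have hI' : ∀ lam, 0 < lam → Integrable (fun ω => Real.exp (lam * X ω)) μ := by
    intro lam hlam
    have := hI (lam / 2) (by linarith)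
    rwa [mul_div_cancel₀ _ two_ne_zero] at this
  refine fun lam hlam => ⟨hI' lam hlam, ?_⟩
  refine le_of_tendsto' (tendsto_integral_of_dominated_convergence
    (F := fun n ω => Real.exp (2 * lam * G n ω)) _ (fun n => (hint _ n).1) (hI lam hlam)
    (fun n => ae_of_all _ fun ω => ?_) (ae_of_all _ fun ω => ?_)) fun n => ?_
  · rw [Real.norm_eq_abs, Real.abs_exp]
    gcongr
    exact hGX n ω
  · exact (Real.continuous_exp.tendsto _).comp ((hlim ω).const_mul _)
  · refine (hdouble lam hlam n).trans ?_
    have hle : ∫ ω, Real.exp (lam * G n ω) ∂μ ≤ ∫ ω, Real.exp (lam * X ω) ∂μ :=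
      integral_mono (hint _ n) (hI' lam hlam) fun ω => by
        dsimp only
        gcongr
        exact hGX n ω
    have h0 : 0 ≤ ∫ ω, Real.exp (lam * G n ω) ∂μ := integral_nonneg fun ω => (Real.exp_pos _).le
    have := (hb lam hlam).le
    gcongr

/-- A consequence of Jensen's inequality for the exponentially tilted measure. -/
lemma mul_deriv_cgf_le [IsProbabilityMeasure μ]
    (hint : ∀ t, Integrable (fun ω => Real.exp (t * X ω)) μ) (lam : ℝ) :
    lam * deriv (cgf X μ) lam ≤ cgf X μ (2 * lam) - cgf X μ lam := by
  have hmem : lam ∈ interior (integrableExpSet X μ) := by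
    rw [show integrableExpSet X μ = univ from eq_univ_of_forall hint, interior_univ]
    trivial
  have hφ : 0 < mgf X μ lam := mgf_pos (hint lam)
  have hφ2 : 0 < mgf X μ (2 * lam) := mgf_pos (hint _)
  have hXint : Integrable (fun ω => X ω * Real.exp (lam * X ω)) μ := by
    simpa using integrable_pow_mul_exp_of_mem_interior_integrableExpSet hmem 1
  set m := lam * deriv (cgf X μ) lam with hm
  have hmval : m * mgf X μ lam = lam * ∫ ω, X ω * Real.exp (lam * X ω) ∂μ := by
    rw [hm, deriv_cgf hmem]
    field_simp
  have hpt : ∀ ω, Real.exp m * ((1 - m) * Real.exp (lam * X ω) +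
      lam * (X ω * Real.exp (lam * X ω))) ≤ Real.exp (2 * lam * X ω) := by
    intro ω
    have h := Real.add_one_le_exp (lam * X ω - m)
    have h2 : Real.exp (2 * lam * X ω) =
        Real.exp m * (Real.exp (lam * X ω - m) * Real.exp (lam * X ω)) := by
      rw [← Real.exp_add, ← Real.exp_add]
      congr 1
      ring
    rw [h2]
    refine mul_le_mul_of_nonneg_left ?_ (Real.exp_pos _).le
    nlinarith [Real.exp_pos (lam * X ω)]
  have hkey : Real.exp m * mgf X μ lam ≤ mgf X μ (2 * lam) := by
    calc Real.exp m * mgf X μ lam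
        = ∫ ω, Real.exp m * ((1 - m) * Real.exp (lam * X ω) +
            lam * (X ω * Real.exp (lam * X ω))) ∂μ := by
          rw [integral_const_mul, integral_add ((hint lam).const_mul _) (hXint.const_mul _),
            integral_const_mul, integral_const_mul, ← hmval, mgf]
          ring
      _ ≤ mgf X μ (2 * lam) :=
          integral_mono ((((hint lam).const_mul _).add (hXint.const_mul _)).const_mul _)
            (hint _) hpt
  have := Real.log_le_log (by positivity) hkey
  rw [Real.log_mul (Real.exp_pos m).ne' hφ.ne', Real.log_exp] at this
  simp only [cgf]
  linarith

lemma cgf_le_of_doubling [IsProbabilityMeasure μ]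
    (hint : ∀ t, Integrable (fun ω => Real.exp (t * X ω)) μ) {b : ℝ → ℝ}
    (hb : ∀ lam, 0 < lam → 0 < b lam) (hmono : MonotoneOn b (Ici 1))
    (hdouble : ∀ lam, 0 < lam → ∫ ω, Real.exp (2 * lam * X ω) ∂μ ≤
      b lam * (∫ ω, Real.exp (lam * X ω) ∂μ) ^ 2) {lam : ℝ} (hlam : 1 ≤ lam) :
    cgf X μ lam ≤ cgf X μ 1 * lam +
      lam * ∫ s in (1 : ℝ)..lam, (s ^ 2)⁻¹ * Real.log (b s) := by
  have hmem : ∀ s, s ∈ interior (integrableExpSet X μ) := fun s => by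
    rw [show integrableExpSet X μ = univ from eq_univ_of_forall hint, interior_univ]
    trivial
  refine le_mul_add_mul_integral_of_deriv_le (L' := deriv (cgf X μ))
    (fun s _ => (analyticAt_cgf (hmem s)).differentiableAt.hasDerivAt)
    (fun s hs t ht hst => Real.log_le_log (hb s (by linarith [mem_Ici.1 hs])) (hmono hs ht hst))
    (fun s hs => ?_) hlam
  have hs0 : 0 < s := by linarith
  have h1 := mul_deriv_cgf_le hint s
  have hφ : 0 < mgf X μ s := mgf_pos (hint s)
  have h2 : mgf X μ (2 * s) ≤ b s * mgf X μ s ^ 2 := hdouble s hs0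
  have h3 := Real.log_le_log (mgf_pos (hint (2 * s))) h2
  rw [Real.log_mul (hb s hs0).ne' (by positivity), Real.log_pow] at h3
  simp only [cgf] at h1 ⊢
  push_cast at h3
  linarith

end Abstract

section Concentration

open ProbabilityTheory Topology

variable {d : ℕ} {α : ℝ} {V : Ed d → ℝ} {β : ℝ → ℝ}

lemma isProbabilityMeasure_muV (hV : Integrable (fun x => Real.exp (-V x))) :
    IsProbabilityMeasure (muV d V) := by
  have hpos : 0 < ∫ x, Real.exp (-V x) := integral_exp_pos hV
  refine ⟨?_⟩
  rw [muV, withDensity_apply _ MeasurableSet.univ, Measure.restrict_univ,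
    ← ofReal_integral_eq_lintegral_ofReal (hV.const_mul _) (ae_of_all _ fun x => by positivity),
    integral_const_mul, inv_mul_cancel₀ hpos.ne', ENNReal.ofReal_one]

/-- The factor `2 β(1 / (c₁ s² e^{2s}))` in the doubling inequality. -/
def doublingFactor (d : ℕ) (α : ℝ) (β : ℝ → ℝ) (s : ℝ) : ℝ :=
  2 * β (1 / (c1const d α * s ^ 2 * Real.exp (2 * s)))

lemma doublingFactor_pos (hd : 1 ≤ d) (hα : α < 2) (hβ : ∀ s, 0 < s → 0 < β s) {s : ℝ}
    (hs : 0 < s) : 0 < doublingFactor d α β s := by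
  have := c1const_pos (d := d) hd hα
  exact mul_pos two_pos (hβ _ (by positivity))

lemma doublingFactor_monotoneOn (hd : 1 ≤ d) (hα : α < 2)
    (hβ : ∀ s t : ℝ, 0 < s → s ≤ t → β t ≤ β s) :
    MonotoneOn (doublingFactor d α β) (Ici 1) := by
  intro s hs t ht hst
  have hc := c1const_pos (d := d) hd hα
  have hs0 : 0 < s := by linarith [mem_Ici.1 hs]
  have ht0 : 0 < t := by linarith
  refine mul_le_mul_of_nonneg_left (hβ _ _ (by positivity) ?_) two_pos.le
  gcongr

lemma integral_exp_double_le (hd : 1 ≤ d) (hα : α < 2)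
    (hSPI : ∀ s : ℝ, 0 < s → ∀ f : Ed d → ℝ, CbSmooth d f →
      ∫ x, (f x) ^ 2 ∂(muV d V) ≤ s * formE d α V f + β s * (∫ x, |f x| ∂(muV d V)) ^ 2)
    {g : Ed d → ℝ} (hg : ∀ x y, |g x - g y| ≤ dist x y) {lam : ℝ} (hlam : 0 < lam)
    (hsmooth : CbSmooth d fun x => Real.exp (lam * g x))
    (hint : Integrable (fun x => Real.exp (2 * lam * g x)) (muV d V)) :
    ∫ x, Real.exp (2 * lam * g x) ∂(muV d V) ≤
      doublingFactor d α β lam * (∫ x, Real.exp (lam * g x) ∂(muV d V)) ^ 2 := by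
  have hc := c1const_pos (d := d) hd hα
  set c := c1const d α * lam ^ 2 * Real.exp (2 * lam) with hcdef
  have hc0 : 0 < c := by positivity
  have h := hSPI (1 / c) (by positivity) _ hsmooth
  have hE := mul_le_mul_of_nonneg_left (formE_exp_le hd hα hg hlam.le hint)
    (show 0 ≤ 1 / c by positivity)
  have hsq : ∀ x, Real.exp (lam * g x) ^ 2 = Real.exp (2 * lam * g x) := fun x => by
    rw [← Real.exp_nat_mul]
    congr 1
    push_cast
    ring
  simp only [hsq, Real.abs_exp] at h
  rw [← hcdef, show 1 / c * (1 / 2 * c * ∫ x, Real.exp (2 * lam * g x) ∂(muV d V)) =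
    (1 / 2) * ∫ x, Real.exp (2 * lam * g x) ∂(muV d V) by field_simp] at hE
  rw [doublingFactor, ← hcdef]
  linarith

lemma exp_norm_doubling (hd : 1 ≤ d) (hα : α < 2)
    (hVint : Integrable (fun x => Real.exp (-V x))) (hβpos : ∀ s : ℝ, 0 < s → 0 < β s)
    (hSPI : ∀ s : ℝ, 0 < s → ∀ f : Ed d → ℝ, CbSmooth d f →
      ∫ x, (f x) ^ 2 ∂(muV d V) ≤ s * formE d α V f + β s * (∫ x, |f x| ∂(muV d V)) ^ 2) :
    ∀ lam : ℝ, 0 < lam → Integrable (fun x => Real.exp (lam * ‖x‖)) (muV d V) ∧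
      ∫ x, Real.exp (2 * lam * ‖x‖) ∂(muV d V) ≤
        doublingFactor d α β lam * (∫ x, Real.exp (lam * ‖x‖) ∂(muV d V)) ^ 2 := by
  have := isProbabilityMeasure_muV hVint
  choose G hGs hGl hGle hGlow K hGK using exists_smooth_truncated_norm d
  have hsm : ∀ lam n, CbSmooth d fun x => Real.exp (lam * G n x) := fun lam n =>
    CbSmooth.of_eq_const_at_infinity (K := Real.exp (lam * K n)) ((contDiff_const.mul (hGs n)).exp)
      fun x hx => by rw [hGK n x hx]
  have hint : ∀ lam n, Integrable (fun x => Real.exp (lam * G n x)) (muV d V) := fun lam n => by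
    obtain ⟨C, hC⟩ := (hsm lam n).2 0
    exact Integrable.of_bound (hsm lam n).1.continuous.aestronglyMeasurable C
      (ae_of_all _ fun x => by simpa using hC x)
  refine doubling_of_approx measurable_norm (fun n => (hGs n).continuous.measurable) hGle
    (fun x => ?_) hint (fun lam hlam => doublingFactor_pos hd hα hβpos hlam)
    fun lam hlam n => integral_exp_double_le hd hα hSPI (hGl n) hlam (hsm lam n) (hint _ n)
  have hlow : Tendsto (fun n : ℕ => ‖x‖ - 1 / ((n : ℝ) + 1)) atTop (𝓝 ‖x‖) := by
    simpa using tendsto_one_div_add_atTop_nhds_zero_nat.const_sub ‖x‖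
  refine tendsto_of_tendsto_of_tendsto_of_le_of_le' hlow tendsto_const_nhds ?_
    (Eventually.of_forall fun n => hGle n x)
  filter_upwards [tendsto_natCast_atTop_atTop.eventually_ge_atTop ‖x‖] with n hn
  exact hGlow n x hn

lemma aestronglyMeasurable_hfun (hd : 1 ≤ d) (hα : α < 2) (hβpos : ∀ s : ℝ, 0 < s → 0 < β s)
    (hβdec : ∀ s t : ℝ, 0 < s → s ≤ t → β t ≤ β s) :
    AEStronglyMeasurable (hfun d α V β) (volume.restrict (Ioi 1)) := by
  set J : ℝ → ℝ := fun s => ((max 1 s) ^ 2)⁻¹ * Real.log (doublingFactor d α β (max 1 s)) with hJ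
  have hmono : Monotone fun s => Real.log (doublingFactor d α β (max 1 s)) := fun s t hst =>
    Real.log_le_log (doublingFactor_pos hd hα hβpos (by positivity))
      (doublingFactor_monotoneOn hd hα hβdec (mem_Ici.2 (le_max_left _ _)) (mem_Ici.2 (le_max_left _ _))
        (max_le_max_left 1 hst))
  have hcont : Continuous fun s : ℝ => ((max 1 s) ^ 2)⁻¹ :=
    Continuous.inv₀ (by fun_prop) fun s => by positivity
  have hJint : ∀ a b, IntervalIntegrable J volume a b := fun a b =>
    hmono.intervalIntegrable.continuousOn_mul hcont.continuousOn
  have hprim : Continuous fun lam => ∫ s in (1 : ℝ)..lam, J s :=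
    intervalIntegral.continuous_primitive hJint 1
  have hH : Continuous fun lam => Real.exp
      (-(1 + Real.log (∫ x, Real.exp ‖x‖ ∂(muV d V))) * lam - lam * ∫ s in (1 : ℝ)..lam, J s) := by
    fun_prop
  refine hH.aestronglyMeasurable.congr ?_
  refine (ae_restrict_iff' measurableSet_Ioi).2 (ae_of_all _ fun lam hlam => ?_)
  have : ∫ s in (1 : ℝ)..lam, J s = ∫ s in (1 : ℝ)..lam, (s ^ 2)⁻¹ *
      Real.log (2 * β (1 / (c1const d α * s ^ 2 * Real.exp (2 * s)))) := by
    refine intervalIntegral.integral_congr fun s hs => ?_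
    rw [uIcc_of_le (mem_Ioi.1 hlam).le] at hs
    simp only [hJ, max_eq_right hs.1, doublingFactor]
  simp only [hfun, this]

end Concentration

/-- concentration of measure from the super Poincaré inequality for
`𝓔_{α,V}`: exponential integrability of every order, and integrability of `F(|x|)`. -/
theorem super_poincare_concentration
    (d : ℕ) (hd : 1 ≤ d) (α : ℝ) (hα : 0 < α ∧ α < 2)
    (V : Ed d → ℝ) (hVmeas : Measurable V) (hVloc : LocallyBounded d V)
    (hVint : Integrable (fun x => Real.exp (-V x)))
    (β : ℝ → ℝ) (hβpos : ∀ s : ℝ, 0 < s → 0 < β s)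
    (hβdec : ∀ s t : ℝ, 0 < s → s ≤ t → β t ≤ β s)
    (hSPI : ∀ s : ℝ, 0 < s → ∀ f : Ed d → ℝ, CbSmooth d f →
      ∫ x, (f x) ^ 2 ∂(muV d V) ≤ s * formE d α V f +
        β s * (∫ x, |f x| ∂(muV d V)) ^ 2) :
    (∀ lam : ℝ, 0 < lam →
      Integrable (fun x : Ed d => Real.exp (lam * ‖x‖)) (muV d V)) ∧
    Integrable (fun x : Ed d => Ffun d α V β ‖x‖) (muV d V) := by
  have := isProbabilityMeasure_muV hVint
  have hdbl := exp_norm_doubling hd hα.2 hVint hβpos hSPI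
  refine ⟨fun lam hlam => (hdbl lam hlam).1, ?_⟩
  have hint : ∀ t : ℝ, Integrable (fun x : Ed d => Real.exp (t * ‖x‖)) (muV d V) := fun t =>
    (hdbl (max t 1) (by positivity)).1.mono' (by fun_prop) (ae_of_all _ fun x => by
      rw [Real.norm_eq_abs, Real.abs_exp]
      gcongr
      exact le_max_left _ _)
  have hle : ∀ lam : ℝ, 1 ≤ lam →
      (∫ x, Real.exp (‖x‖ * lam) ∂(muV d V)) * hfun d α V β lam ≤ Real.exp (-lam) := by
    intro lam hlam
    have h := cgf_le_of_doubling (X := fun x : Ed d => ‖x‖) hint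
      (fun s hs => doublingFactor_pos hd hα.2 hβpos hs)
      (doublingFactor_monotoneOn hd hα.2 hβdec) (fun s hs => (hdbl s hs).2) hlam
    have hm : ∫ x, Real.exp (‖x‖ * lam) ∂(muV d V) =
        Real.exp (ProbabilityTheory.cgf (fun x : Ed d => ‖x‖) (muV d V) lam) := by
      rw [ProbabilityTheory.exp_cgf (hint lam), ProbabilityTheory.mgf]
      simp only [mul_comm]
    simp only [doublingFactor] at h
    rw [hm, hfun, ← Real.exp_add, Real.exp_le_exp]
    simp only [ProbabilityTheory.cgf, ProbabilityTheory.mgf, one_mul] at h ⊢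
    linarith
  have hh := aestronglyMeasurable_hfun (V := V) hd hα.2 hβpos hβdec
  have hmeas : AEStronglyMeasurable
      (fun p : Ed d × ℝ => Real.exp (‖p.1‖ * p.2) * hfun d α V β p.2)
      ((muV d V).prod (volume.restrict (Ioi 1))) :=
    (by fun_prop : Continuous fun p : Ed d × ℝ => Real.exp (‖p.1‖ * p.2)).aestronglyMeasurable.mul
      hh.comp_snd
  have hprod : Integrable (fun p : Ed d × ℝ => Real.exp (‖p.1‖ * p.2) * hfun d α V β p.2)
      ((muV d V).prod (volume.restrict (Ioi 1))) := by
    refine (integrable_prod_iff' hmeas).2 ⟨ae_of_all _ fun lam => ?_, ?_⟩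
    · simpa only [mul_comm] using (hint lam).mul_const (hfun d α V β lam)
    · refine (integrableOn_exp_neg_Ioi 1).mono' hmeas.norm.prod_swap.integral_prod_right' ?_
      refine (ae_restrict_iff' measurableSet_Ioi).2 (ae_of_all _ fun lam hlam => ?_)
      have hpos : ∀ x : Ed d, 0 ≤ Real.exp (‖x‖ * lam) * hfun d α V β lam := fun x =>
        mul_nonneg (Real.exp_pos _).le (Real.exp_pos _).le
      simp only [Real.norm_eq_abs, abs_of_nonneg (hpos _)]
      rw [abs_of_nonneg (integral_nonneg hpos), integral_mul_const]
      exact hle lam (mem_Ioi.1 hlam).le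
  exact hprod.integral_prod_left
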